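/- arXiv:2501.06098 — 2 statements merged into one kernel-verified Lean document; each statement's English description precedes it below -/
import Mathlib

section
/- For all i₁, i₂ ∈ {1,…,m}, the entries satisfy (c₁/(𝔐·exp(−0.5))) · exp(Q̄K̄ᵀ)_{i₁ i₂} ≤ (exp(Q̄)exp(K̄)ᵀ)_{i₁ i₂} ≤ (c₁/(𝓜·exp(−0.5))) · exp(Q̄K̄ᵀ)_{i₁ i₂}. -/
open Matrix Finset

/-- Entrywise exponential of a real matrix. -/
noncomputable def eexp {α β : Type*} (A : Matrix α β ℝ) : Matrix α β ℝ := A.map Real.exp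

/-- Frobenius norm of a real matrix. -/
noncomputable def frob {α β : Type*} [Fintype α] [Fintype β] (A : Matrix α β ℝ) : ℝ :=
  Real.sqrt (∑ i, ∑ j, (A i j) ^ 2)

/-- The all-ones square matrix. -/
def allOnes (α : Type*) : Matrix α α ℝ := Matrix.of fun _ _ => 1

/-- 𝔐: the maximum of exp(⟨q̄ᵢ₁, k̄ᵢ₂⟩ + 0.5 − (q̄ᵢ₁ⱼ + k̄ᵢ₂ⱼ)). -/
noncomputable def bigM {ι : Type*} [Fintype ι] [Nonempty ι] {c₁ : ℕ} [NeZero c₁]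
    (Q K : Matrix ι (Fin c₁) ℝ) : ℝ :=
  Finset.univ.sup' Finset.univ_nonempty fun p : ι × ι × Fin c₁ =>
    Real.exp ((∑ j, Q p.1 j * K p.2.1 j) + 0.5 - (Q p.1 p.2.2 + K p.2.1 p.2.2))

/-- 𝓜: the minimum of exp(⟨q̄ᵢ₁, k̄ᵢ₂⟩ + 0.5 − (q̄ᵢ₁ⱼ + k̄ᵢ₂ⱼ)). -/
noncomputable def smallM {ι : Type*} [Fintype ι] [Nonempty ι] {c₁ : ℕ} [NeZero c₁]
    (Q K : Matrix ι (Fin c₁) ℝ) : ℝ :=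
  Finset.univ.inf' Finset.univ_nonempty fun p : ι × ι × Fin c₁ =>
    Real.exp ((∑ j, Q p.1 j * K p.2.1 j) + 0.5 - (Q p.1 p.2.2 + K p.2.1 p.2.2))

/-- Z = I_b ⊗ U_p : the block-diagonal 0/1 mask with b diagonal all-ones p×p blocks. -/
def blockZ (b p : ℕ) : Matrix (Fin b × Fin p) (Fin b × Fin p) ℝ :=
  Matrix.kroneckerMap (· * ·) (1 : Matrix (Fin b) (Fin b) ℝ) (allOnes (Fin p))

section
variable {ι : Type*} [Fintype ι] [Nonempty ι] {c₁ : ℕ} [NeZero c₁]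

theorem exp_le_bigM (Q K : Matrix ι (Fin c₁) ℝ) (i₁ i₂ : ι) (j : Fin c₁) :
    Real.exp ((∑ l, Q i₁ l * K i₂ l) + 0.5 - (Q i₁ j + K i₂ j)) ≤ bigM Q K :=
  Finset.le_sup' (fun p : ι × ι × Fin c₁ =>
    Real.exp ((∑ j, Q p.1 j * K p.2.1 j) + 0.5 - (Q p.1 p.2.2 + K p.2.1 p.2.2)))
    (Finset.mem_univ (i₁, i₂, j))

theorem smallM_le_exp (Q K : Matrix ι (Fin c₁) ℝ) (i₁ i₂ : ι) (j : Fin c₁) :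
    smallM Q K ≤ Real.exp ((∑ l, Q i₁ l * K i₂ l) + 0.5 - (Q i₁ j + K i₂ j)) :=
  Finset.inf'_le (fun p : ι × ι × Fin c₁ =>
    Real.exp ((∑ j, Q p.1 j * K p.2.1 j) + 0.5 - (Q p.1 p.2.2 + K p.2.1 p.2.2)))
    (Finset.mem_univ (i₁, i₂, j))

theorem smallM_pos (Q K : Matrix ι (Fin c₁) ℝ) : 0 < smallM Q K :=
  (Finset.lt_inf'_iff _).2 fun _ _ => Real.exp_pos _

end

theorem eexp_mul_transpose_apply {ι κ : Type*} [Fintype κ] (Q K : Matrix ι κ ℝ) (i₁ i₂ : ι) :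
    eexp (Q * Kᵀ) i₁ i₂ = Real.exp (∑ l, Q i₁ l * K i₂ l) := by
  simp [eexp, Matrix.mul_apply]

theorem eexp_mul_eexp_transpose_apply {ι κ : Type*} [Fintype κ] (Q K : Matrix ι κ ℝ)
    (i₁ i₂ : ι) :
    (eexp Q * (eexp K)ᵀ) i₁ i₂ = ∑ j, Real.exp (Q i₁ j + K i₂ j) := by
  simp [eexp, Matrix.mul_apply, Real.exp_add]

theorem exp_eq_exp_add_half_sub_mul (s t : ℝ) :
    Real.exp s = Real.exp t * (Real.exp (s + 0.5 - t) * Real.exp (-0.5)) := by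
  rw [← Real.exp_add, ← Real.exp_add]
  ring_nf

/-- entrywise bounds
(c₁/(𝔐·exp(−0.5))) · exp(Q̄K̄ᵀ)_{i₁i₂} ≤ (exp(Q̄)exp(K̄)ᵀ)_{i₁i₂}
  ≤ (c₁/(𝓜·exp(−0.5))) · exp(Q̄K̄ᵀ)_{i₁i₂}. -/
theorem stmt_3 (m c₁ : ℕ) [NeZero m] [NeZero c₁] (Qb Kb : Matrix (Fin m) (Fin c₁) ℝ) :
    ∀ i₁ i₂ : Fin m,
      (c₁ : ℝ) / (bigM Qb Kb * Real.exp (-0.5)) * eexp (Qb * Kbᵀ) i₁ i₂ ≤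
          (eexp Qb * (eexp Kb)ᵀ) i₁ i₂ ∧
        (eexp Qb * (eexp Kb)ᵀ) i₁ i₂ ≤
          (c₁ : ℝ) / (smallM Qb Kb * Real.exp (-0.5)) * eexp (Qb * Kbᵀ) i₁ i₂ := by
  intro i₁ i₂
  rw [eexp_mul_transpose_apply, eexp_mul_eexp_transpose_apply]
  have hsmall := smallM_pos Qb Kb
  have hbig : 0 < bigM Qb Kb := (Real.exp_pos _).trans_le (exp_le_bigM Qb Kb i₁ i₂ 0)
  have hconst (a : ℝ) : (c₁ : ℝ) / a * Real.exp (∑ l, Qb i₁ l * Kb i₂ l) =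
      ∑ _j : Fin c₁, Real.exp (∑ l, Qb i₁ l * Kb i₂ l) / a := by
    rw [Finset.sum_const, Finset.card_univ, Fintype.card_fin, nsmul_eq_mul]
    ring
  rw [hconst, hconst]
  constructor <;> refine Finset.sum_le_sum fun j _ => ?_
  · rw [div_le_iff₀ (by positivity),
      exp_eq_exp_add_half_sub_mul (∑ l, Qb i₁ l * Kb i₂ l) (Qb i₁ j + Kb i₂ j)]
    gcongr
    exact exp_le_bigM Qb Kb i₁ i₂ j
  · rw [le_div_iff₀ (by positivity),
      exp_eq_exp_add_half_sub_mul (∑ l, Qb i₁ l * Kb i₂ l) (Qb i₁ j + Kb i₂ j)]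
    gcongr
    exact smallM_le_exp Qb Kb i₁ i₂ j
end

section
/- Let γ be the standard Gaussian measure on ℝ^c (the product of c copies of the standard normal distribution N(0,1)) and let e(v) = exp(−‖v‖²/2) for v ∈ ℝ^c. Then for any x, y₁, …, y_m ∈ ℝ^c and any i ∈ {1,…,m}, the normalized attention scores coincide: exp(⟨x, y_i⟩) / Σ_{j=1}^m exp(⟨x, y_j⟩) = (∫ exp(⟨ω, x⟩) exp(⟨ω, y_i⟩) e(y_i) dγ(ω)) / (Σ_{j=1}^m ∫ exp(⟨ω, x⟩) exp(⟨ω, y_j⟩) e(y_j) dγ(ω)). -/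
open MeasureTheory

/-- The moment generating function of the standard Gaussian measure on `ι → ℝ`. -/
theorem integral_exp_sum_mul_pi_gaussianReal {ι : Type*} [Fintype ι] (t : ι → ℝ) :
    ∫ ω : ι → ℝ, Real.exp (∑ l, ω l * t l)
        ∂(Measure.pi fun _ : ι => ProbabilityTheory.gaussianReal 0 1) =
      Real.exp (∑ l, t l ^ 2 / 2) := by
  have h (s : ℝ) : ∫ a, Real.exp (a * s) ∂ProbabilityTheory.gaussianReal 0 1 =
      Real.exp (s ^ 2 / 2) := by
    simpa [ProbabilityTheory.mgf, mul_comm] using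
      congrFun (ProbabilityTheory.mgf_id_gaussianReal (μ := 0) (v := 1)) s
  simp_rw [Real.exp_sum]
  rw [integral_fintype_prod_eq_prod (f := fun l (a : ℝ) => Real.exp (a * t l))]
  simp_rw [h]

/-- Positive random features are unbiased for the softmax kernel, up to the factor
`exp (‖x‖ ^ 2 / 2)`. -/
theorem integral_exp_mul_exp_mul_exp_pi_gaussianReal {ι : Type*} [Fintype ι] (x y : ι → ℝ) :
    ∫ ω : ι → ℝ,
        Real.exp (∑ l, ω l * x l) * Real.exp (∑ l, ω l * y l) *
          Real.exp (-(∑ l, y l ^ 2) / 2)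
        ∂(Measure.pi fun _ : ι => ProbabilityTheory.gaussianReal 0 1) =
      Real.exp (∑ l, x l ^ 2 / 2) * Real.exp (∑ l, x l * y l) := by
  rw [integral_mul_const]
  simp_rw [← Real.exp_add, ← Finset.sum_add_distrib, ← mul_add]
  rw [integral_exp_sum_mul_pi_gaussianReal, ← Real.exp_add, neg_div, Finset.sum_div,
    ← Finset.sum_neg_distrib, ← Finset.sum_add_distrib]
  congr 1
  exact Finset.sum_congr rfl fun l _ => by ring

/-- for the standard Gaussian measure γ on ℝ^c and e(v) = exp(−‖v‖²/2),
the normalized attention scores coincide: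
exp(⟨x, yᵢ⟩) / Σⱼ exp(⟨x, yⱼ⟩)
  = (∫ exp(⟨ω,x⟩) exp(⟨ω,yᵢ⟩) e(yᵢ) dγ(ω)) / (Σⱼ ∫ exp(⟨ω,x⟩) exp(⟨ω,yⱼ⟩) e(yⱼ) dγ(ω)). -/
theorem stmt_19 (c m : ℕ) [NeZero c] [NeZero m] (x : Fin c → ℝ) (y : Fin m → Fin c → ℝ)
    (i : Fin m) :
    Real.exp (∑ l, x l * y i l) / (∑ j, Real.exp (∑ l, x l * y j l)) =
      (∫ ω : Fin c → ℝ,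
          Real.exp (∑ l, ω l * x l) * Real.exp (∑ l, ω l * y i l) *
            Real.exp (-(∑ l, (y i l) ^ 2) / 2)
          ∂(Measure.pi fun _ : Fin c => ProbabilityTheory.gaussianReal 0 1)) /
        (∑ j, ∫ ω : Fin c → ℝ,
            Real.exp (∑ l, ω l * x l) * Real.exp (∑ l, ω l * y j l) *
              Real.exp (-(∑ l, (y j l) ^ 2) / 2)
            ∂(Measure.pi fun _ : Fin c => ProbabilityTheory.gaussianReal 0 1)) := by
  simp_rw [integral_exp_mul_exp_mul_exp_pi_gaussianReal]
  rw [← Finset.mul_sum, mul_div_mul_left _ _ (Real.exp_ne_zero _)]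
end
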